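/- Let B be a real unital Banach algebra (a complete normed unital ℝ-algebra) such that 1 + x² is invertible in B for every x ∈ B. Then the quotient of B by its Jacobson radical is commutative; equivalently, for all a, b ∈ B the commutator a·b − b·a belongs to the Jacobson radical of B. -/

import Mathlib

noncomputable section

/-- A bounded operator on a nontrivial real normed space has a (possibly complex) spectral value
`a + bi`, in the sense that `(L - a)² + b²` is not invertible. -/
theorem ContinuousLinearMap.exists_not_isUnit_sq_add_sq {V : Type*} [NormedAddCommGroup V]
    [NormedSpace ℝ V] [Nontrivial V] (L : V →L[ℝ] V) :
    ∃ a b : ℝ, ¬ IsUnit ((L - algebraMap ℝ _ a) * (L - algebraMap ℝ _ a) +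
      algebraMap ℝ (V →L[ℝ] V) (b * b)) := by
  let T (K : V →L[ℝ] V) : (V →L[ℝ] ℂ) →L[ℂ] (V →L[ℝ] ℂ) :=
    LinearMap.mkContinuous
      { toFun := fun φ ↦ φ.comp K
        map_add' := fun φ ψ ↦ φ.add_comp ψ K
        map_smul' := fun c φ ↦ φ.smul_comp c K } ‖K‖
      (fun φ ↦ (φ.opNorm_comp_le K).trans_eq (mul_comm _ _))
  have hT (K φ v) : T K φ v = φ (K v) := rfl
  have hT_mul (K K') : T (K * K') = T K' * T K := rfl
  have hT_one : T 1 = 1 := rfl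
  have : Nontrivial (V →L[ℝ] ℂ) := by
    obtain ⟨v, hv⟩ := exists_ne (0 : V)
    obtain ⟨f, -, hf⟩ := exists_dual_vector ℝ v (norm_ne_zero_iff.mpr hv)
    refine ⟨Complex.ofRealCLM.comp f, 0, fun h ↦ hv ?_⟩
    simpa [hf] using DFunLike.congr_fun h v
  obtain ⟨z, hz⟩ := spectrum.nonempty (T L)
  refine ⟨z.re, z.im, fun hu ↦ hz ?_⟩
  have hfac : T ((L - algebraMap ℝ _ z.re) * (L - algebraMap ℝ _ z.re) +
      algebraMap ℝ (V →L[ℝ] V) (z.im * z.im)) =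
      (z • 1 - T L) * (starRingEnd ℂ z • 1 - T L) := by
    ext φ v
    simp only [hT, Algebra.algebraMap_eq_smul_one]
    apply Complex.ext <;> simp [hT] <;> ring
  have hcomm : Commute (z • 1 - T L) (starRingEnd ℂ z • 1 - T L) := by
    ext φ v
    simp [hT]
    ring
  rw [spectrum.mem_resolventSet_iff, Algebra.algebraMap_eq_smul_one]
  obtain ⟨K, hK, hK'⟩ := isUnit_iff_exists.mp hu
  refine (hcomm.isUnit_mul_iff.mp ?_).1
  rw [← hfac]
  exact isUnit_iff_exists.mpr ⟨T K, by rw [← hT_mul, hK', hT_one], by rw [← hT_mul, hK, hT_one]⟩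

theorem Ideal.IsMaximal.exists_mul_sub_mem {R : Type*} [Ring R] {M : Ideal R} (hM : M.IsMaximal)
    {x : R} (hx : x ∉ M) (c : R) : ∃ y, y * x - c ∈ M := by
  have : c ∈ Ideal.span {x} ⊔ M := by
    rw [hM.out.2 _ (right_lt_sup.mpr (by simpa using hx))]
    trivial
  obtain ⟨y, m, hm, rfl⟩ := Ideal.mem_span_singleton_sup.mp this
  exact ⟨y, by simpa using hm⟩

theorem Ideal.IsMaximal.isTwoSided_of_isUnit_one_add_sq {R : Type*} [Ring R]
    (h : ∀ x : R, IsUnit (1 + x * x)) {M : Ideal R} (hM : M.IsMaximal) : M.IsTwoSided := by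
  refine ⟨fun {m} c hm ↦ by_contra fun hmc ↦ ?_⟩
  obtain ⟨y, hy⟩ := hM.exists_mul_sub_mem hmc (-1 - c * c)
  refine hM.ne_top (M.eq_top_of_isUnit_mem ?_ (h (c + y * m)))
  have : 1 + (c + y * m) * (c + y * m) =
      (y * (m * c) - (-1 - c * c)) + (c + y * m) * y * m := by noncomm_ring
  rw [this]
  exact M.add_mem hy (M.mul_mem_left _ hm)

/-- The action of `B` by bounded operators on its quotient by a left ideal. -/
def Ideal.quotientAction {B : Type*} [NormedRing B] [NormedAlgebra ℝ B] (M : Ideal B)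
    [IsClosed (M : Set B)] : B →ₐ[ℝ] ((B ⧸ M) →L[ℝ] (B ⧸ M)) where
  toFun x := ⟨Algebra.lsmul ℝ ℝ (B ⧸ M) x, continuous_const_smul x⟩
  map_one' := by ext; simp
  map_mul' x y := ContinuousLinearMap.ext (mul_smul x y)
  map_zero' := by ext; simp
  map_add' x y := ContinuousLinearMap.ext (add_smul x y)
  commutes' r := by ext; simp [Algebra.algebraMap_eq_smul_one]

theorem Ideal.IsMaximal.exists_sub_algebraMap_mem {B : Type*} [NormedRing B] [NormedAlgebra ℝ B]
    [CompleteSpace B] (h : ∀ x : B, IsUnit (1 + x * x)) {M : Ideal B} (hM : M.IsMaximal) (x : B) :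
    ∃ a : ℝ, x - algebraMap ℝ B a ∈ M := by
  have := hM.isTwoSided_of_isUnit_one_add_sq h
  have : Nontrivial (B ⧸ M) := Submodule.Quotient.nontrivial_iff.mpr hM.ne_top
  have hker {y z : B} (hyz : y - z ∈ M) : M.quotientAction y = M.quotientAction z := by
    rw [← sub_eq_zero, ← map_sub]
    ext s
    obtain ⟨s, rfl⟩ := Submodule.Quotient.mk_surjective M s
    exact (Submodule.Quotient.mk_eq_zero M).mpr (M.mul_mem_right s hyz)
  obtain ⟨a, b, hab⟩ := (M.quotientAction x).exists_not_isUnit_sq_add_sq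
  refine ⟨a, ?_⟩
  set y := x - algebraMap ℝ B a with hy
  have hmem : y * y + algebraMap ℝ B (b * b) ∈ M := by
    by_contra hp
    refine hab ?_
    obtain ⟨q, hq⟩ := hM.exists_mul_sub_mem hp 1
    have hqM : q ∉ M := fun hqM ↦ hM.ne_top <| (Ideal.eq_top_iff_one M).mpr <| by
      simpa using M.sub_mem (M.mul_mem_right (y * y + algebraMap ℝ B (b * b)) hqM) hq
    obtain ⟨r, hr⟩ := hM.exists_mul_sub_mem hqM 1
    have hq' := hker hq
    have hr' := hker hr
    rw [map_mul, map_one] at hq' hr'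
    have hrp := left_inv_eq_right_inv hr' hq'
    rw [hrp] at hr'
    have := isUnit_iff_exists.mpr ⟨_, hr', hq'⟩
    simpa [hy] using this
  by_contra hyM
  rcases eq_or_ne b 0 with rfl | hb
  · obtain ⟨q, hq⟩ := hM.exists_mul_sub_mem hyM 1
    refine hyM ?_
    have := M.sub_mem (M.mul_mem_left q hmem) (M.mul_mem_right y hq)
    simpa [sub_mul, mul_assoc] using this
  · refine hM.ne_top (M.eq_top_of_isUnit_mem ?_ (h (b⁻¹ • y)))
    have := M.mul_mem_left (algebraMap ℝ B (b⁻¹ * b⁻¹)) hmem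
    convert this using 1
    rw [mul_add, ← map_mul, ← Algebra.smul_def, smul_mul_smul_comm,
      show b⁻¹ * b⁻¹ * (b * b) = 1 by field_simp, map_one, add_comm]

/-- Kaplansky-type theorem: a real Banach algebra in which `1 + x²` is always invertible is
commutative modulo its Jacobson radical. -/
theorem commutator_mem_jacobson_of_isUnit_one_add_sq
    {B : Type*} [NormedRing B] [NormedAlgebra ℝ B] [CompleteSpace B]
    (h : ∀ x : B, IsUnit (1 + x * x)) :
    ∀ a b : B, a * b - b * a ∈ Ideal.jacobson (⊥ : Ideal B) := by
  intro x y
  refine Submodule.mem_sInf.mpr fun (M : Ideal B) ⟨_, hM⟩ ↦ ?_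
  have := hM.isTwoSided_of_isUnit_one_add_sq h
  obtain ⟨a, ha⟩ := hM.exists_sub_algebraMap_mem h x
  have : x * y - y * x = (x - algebraMap ℝ B a) * y - y * (x - algebraMap ℝ B a) := by
    rw [sub_mul, mul_sub, Algebra.commutes]
    abel
  rw [this]
  exact M.sub_mem (M.mul_mem_right y ha) (M.mul_mem_left y ha)
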